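/- Write x_{ij} = x_i − x_j, fix r ∈ ℝ with r ≠ 0, and let U = {x ∈ ℝ⁴ : the coordinates x₁,x₂,x₃,x₄ are pairwise distinct}. Define for λ ∈ ℝ the vector fields X₁(λ) = −((x₁₄x₃₄ − r(x₁₄x₂₄ + x₁₄x₃₄ + x₂₄x₃₄))/(r·x₁₂x₃₄))(λ−x₁)∂₁ + ((x₂₄x₃₄ − r(x₁₄x₂₄ + x₁₄x₃₄ + x₂₄x₃₄))/(r·x₁₂x₃₄))(λ−x₂)∂₂ − (λ−x₄)∂₄ and X₂(λ) = −(x₂₃x₁₄/(x₁₂x₃₄))(λ−x₁)∂₁ + (x₁₃x₂₄/(x₁₂x₃₄))(λ−x₂)∂₂ − (λ−x₃)∂₃. Then for every λ ∈ ℝ, [X₁(λ),X₂(λ)] = 0 on U. -/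

import Mathlib

open scoped BigOperators

/-- Partial derivative `∂f/∂x_j` on ℝ⁴ (coordinates `x₁,…,x₄` are indexed by `Fin 4`,
so `x_i` corresponds to index `i-1`). -/
noncomputable def pd (f : (Fin 4 → ℝ) → ℝ) (j : Fin 4) (x : Fin 4 → ℝ) : ℝ :=
  fderiv ℝ f x (Pi.single j 1)

/-- Lie bracket of vector fields on ℝ⁴:
`[X,Y]^i = ∑_j (X^j ∂_j Y^i − Y^j ∂_j X^i)`. -/
noncomputable def lieB (X Y : (Fin 4 → ℝ) → (Fin 4 → ℝ)) (x : Fin 4 → ℝ) : Fin 4 → ℝ :=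
  fun i => ∑ j, (X x j * pd (fun y => Y y i) j x - Y x j * pd (fun y => X y i) j x)

/-- The first vector field `X₁(λ)` of Example 2 (case A₀, parameter `r`);
`x_{ij} = x_i − x_j` with 1-based indices mapped to `Fin 4`. -/
noncomputable def X1 (r lam : ℝ) (y : Fin 4 → ℝ) : Fin 4 → ℝ :=
  ![-(((y 0 - y 3) * (y 2 - y 3)
        - r * ((y 0 - y 3) * (y 1 - y 3) + (y 0 - y 3) * (y 2 - y 3)
              + (y 1 - y 3) * (y 2 - y 3)))
      / (r * (y 0 - y 1) * (y 2 - y 3))) * (lam - y 0),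
    (((y 1 - y 3) * (y 2 - y 3)
        - r * ((y 0 - y 3) * (y 1 - y 3) + (y 0 - y 3) * (y 2 - y 3)
              + (y 1 - y 3) * (y 2 - y 3)))
      / (r * (y 0 - y 1) * (y 2 - y 3))) * (lam - y 1),
    0,
    -(lam - y 3)]

/-- The second vector field `X₂(λ)` of Example 2 (case A₀). -/
noncomputable def X2 (lam : ℝ) (y : Fin 4 → ℝ) : Fin 4 → ℝ :=
  ![-((y 1 - y 2) * (y 0 - y 3) / ((y 0 - y 1) * (y 2 - y 3))) * (lam - y 0),
    ((y 0 - y 2) * (y 1 - y 3) / ((y 0 - y 1) * (y 2 - y 3))) * (lam - y 1),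
    -(lam - y 2),
    0]

section PartialDerivative

variable {f g : (Fin 4 → ℝ) → ℝ} {x : Fin 4 → ℝ}

theorem pd_const (c : ℝ) (j : Fin 4) (x : Fin 4 → ℝ) : pd (fun _ => c) j x = 0 := by
  simp [pd]

theorem pd_coord (i j : Fin 4) (x : Fin 4 → ℝ) :
    pd (fun y => y i) j x = if i = j then 1 else 0 := by
  have h := hasFDerivAt_apply (𝕜 := ℝ) i x
  simp [pd, h.fderiv, Pi.single_apply]

theorem pd_neg (j : Fin 4) : pd (fun y => -f y) j x = -pd f j x := by
  simp [pd, fderiv_fun_neg]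

theorem pd_add (hf : DifferentiableAt ℝ f x) (hg : DifferentiableAt ℝ g x) (j : Fin 4) :
    pd (fun y => f y + g y) j x = pd f j x + pd g j x := by
  simp [pd, fderiv_fun_add hf hg]

theorem pd_sub (hf : DifferentiableAt ℝ f x) (hg : DifferentiableAt ℝ g x) (j : Fin 4) :
    pd (fun y => f y - g y) j x = pd f j x - pd g j x := by
  simp [pd, fderiv_fun_sub hf hg]

theorem pd_mul (hf : DifferentiableAt ℝ f x) (hg : DifferentiableAt ℝ g x) (j : Fin 4) :
    pd (fun y => f y * g y) j x = f x * pd g j x + g x * pd f j x := by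
  simp [pd, fderiv_fun_mul hf hg]

theorem pd_div (hf : DifferentiableAt ℝ f x) (hg : DifferentiableAt ℝ g x) (hx : g x ≠ 0)
    (j : Fin 4) :
    pd (fun y => f y / g y) j x = (g x * pd f j x - f x * pd g j x) / g x ^ 2 := by
  have h := hf.hasFDerivAt.fun_mul ((hasDerivAt_inv hx).comp_hasFDerivAt x hg.hasFDerivAt)
  simp only [Function.comp_apply] at h
  simp only [pd, div_eq_mul_inv, h.fderiv, add_apply, smul_apply, smul_eq_mul]
  field_simp
  ring

end PartialDerivative

/-- For `r ≠ 0`, on `U = {x : coordinates pairwise distinct}`, for every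
`λ ∈ ℝ` the vector fields `X₁(λ)` and `X₂(λ)` commute: `[X₁(λ),X₂(λ)] = 0`. -/
theorem example2_vector_fields_commute (r : ℝ) (hr : r ≠ 0) :
    ∀ lam : ℝ, ∀ x : Fin 4 → ℝ,
      (∀ i j : Fin 4, i ≠ j → x i ≠ x j) →
      lieB (X1 r lam) (X2 lam) x = 0 := by
  intro lam x hx
  have h01 : x 0 - x 1 ≠ 0 := sub_ne_zero.mpr (hx 0 1 (by decide))
  have h23 : x 2 - x 3 ≠ 0 := sub_ne_zero.mpr (hx 2 3 (by decide))
  have hd : (x 0 - x 1) * (x 2 - x 3) ≠ 0 := mul_ne_zero h01 h23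
  have hrd : r * (x 0 - x 1) * (x 2 - x 3) ≠ 0 := mul_ne_zero (mul_ne_zero hr h01) h23
  funext i
  fin_cases i <;>
    simp (disch := first | assumption | fun_prop (disch := assumption)) only
      [lieB, X1, X2, Fin.sum_univ_four, Fin.zero_eta, Fin.mk_one, Fin.reduceFinMk, Fin.isValue,
        Matrix.cons_val, Pi.zero_apply, pd_const, pd_coord, pd_neg, pd_add, pd_sub, pd_mul, pd_div,
        Fin.reduceEq, if_true, if_false] <;>
    field_simp <;>
    ring
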